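/- Assume g is μ-strongly convex with 0 < μ < L and set γ = μ/L. Consider the accelerated inexact proximal-gradient method for strongly convex objectives: y_k = x_k + ((1 − √γ)/(1 + √γ))(x_k − x_{k-1}) with y_0 = x_0, and for each k ≥ 1, x_k is an ε_k-optimal solution of the proximal problem at y_{k-1} − (1/L)(g'(y_{k-1}) + e_k). Suppose there exist C' ≥ 0 and Q' with 0 ≤ Q' < 1 − √γ such that ‖e_k‖² ≤ C' (Q')^k and ε_k ≤ C' (Q')^k for all k ≥ 1. Then there exists a constant C such that for all k ≥ 1, f(x_k) − f(x*) ≤ C (1 − √γ)^k; i.e., the function values converge linearly with rate (1 − √γ). -/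

import Mathlib

open scoped RealInnerProductSpace
open Finset

noncomputable section

variable {E : Type*} [NormedAddCommGroup E] [InnerProductSpace ℝ E] [CompleteSpace E]

/-- The ε-subdifferential of an `EReal`-valued function `a` at `x`:
the set of `y` such that `a t ≥ a x + ⟪y, t - x⟫ - ε` for all `t`. -/
def epsSubdiff (a : E → EReal) (ε : ℝ) (x : E) : Set E :=
  {y | ∀ t : E, a x + ((⟪y, t - x⟫ : ℝ) : EReal) - ((ε : ℝ) : EReal) ≤ a t}

/-- The objective function of the proximal problem at `y`. -/
def proxObj (L : ℝ) (h : E → EReal) (y x : E) : EReal :=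
  ((L / 2 * ‖x - y‖ ^ 2 : ℝ) : EReal) + h x

/-- `x` is an `ε`-optimal solution of the proximal problem at `y`. -/
def IsEpsOptimal (L : ℝ) (h : E → EReal) (ε : ℝ) (y x : E) : Prop :=
  proxObj L h y x ≤ ((ε : ℝ) : EReal) + ⨅ z : E, proxObj L h y z

/-- Convexity for `EReal`-valued functions. -/
def ERealConvexOn (h : E → EReal) : Prop :=
  ∀ x y : E, ∀ a b : ℝ, 0 ≤ a → 0 ≤ b → a + b = 1 →
    h (a • x + b • y) ≤ ((a : ℝ) : EReal) * h x + ((b : ℝ) : EReal) * h y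

/-- The descent lemma: a function with `L`-Lipschitz gradient lies below its quadratic upper
model. -/
theorem le_quadratic_of_lipschitz_gradient {L : ℝ} {g : E → ℝ} {g' : E → E}
    (hgrad : ∀ w, HasGradientAt g (g' w) w)
    (hlip : ∀ w w', ‖g' w - g' w'‖ ≤ L * ‖w - w'‖) (w w' : E) :
    g w' ≤ g w + ⟪g' w, w' - w⟫ + L / 2 * ‖w' - w‖ ^ 2 := by
  set d := w' - w with hd
  let ψ : ℝ → ℝ := fun t => g (w + t • d) - t * ⟪g' w, d⟫ - L / 2 * ‖d‖ ^ 2 * t ^ 2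
  have hψ : ∀ t, HasDerivAt ψ
      (⟪g' (w + t • d), d⟫ - ⟪g' w, d⟫ - L / 2 * ‖d‖ ^ 2 * (2 * t)) t := by
    intro t
    have hline : HasDerivAt (fun t : ℝ => w + t • d) d t := by
      simpa using ((hasDerivAt_id t).smul_const d).const_add w
    have hcomp : HasDerivAt (fun t : ℝ => g (w + t • d)) ⟪g' (w + t • d), d⟫ t := by
      have := (hgrad (w + t • d)).hasFDerivAt.comp_hasDerivAt t hline
      rwa [InnerProductSpace.toDual_apply_apply] at this
    have hlin : HasDerivAt (fun t : ℝ => t * ⟪g' w, d⟫) ⟪g' w, d⟫ t := by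
      simpa using (hasDerivAt_id t).mul_const ⟪g' w, d⟫
    have hsq : HasDerivAt (fun t : ℝ => L / 2 * ‖d‖ ^ 2 * t ^ 2)
        (L / 2 * ‖d‖ ^ 2 * (2 * t)) t := by
      simpa using (hasDerivAt_pow 2 t).const_mul (L / 2 * ‖d‖ ^ 2)
    exact (hcomp.sub hlin).sub hsq
  have hanti : AntitoneOn ψ (Set.Icc 0 1) := by
    refine antitoneOn_of_deriv_nonpos (convex_Icc 0 1)
      (fun t _ => (hψ t).continuousAt.continuousWithinAt)
      (fun t _ => (hψ t).differentiableAt.differentiableWithinAt) fun t ht => ?_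
    rw [interior_Icc] at ht
    rw [(hψ t).deriv, ← inner_sub_left]
    have hcs := real_inner_le_norm (g' (w + t • d) - g' w) d
    have hl := hlip (w + t • d) w
    rw [add_sub_cancel_left, norm_smul, Real.norm_of_nonneg ht.1.le] at hl
    nlinarith [mul_le_mul_of_nonneg_right hl (norm_nonneg d)]
  have h01 := hanti (Set.left_mem_Icc.2 zero_le_one) (Set.right_mem_Icc.2 zero_le_one) zero_le_one
  have hw' : w + d = w' := by rw [hd]; abel
  simp only [ψ, one_smul, zero_smul, add_zero, hw'] at h01
  linarith

omit [CompleteSpace E] in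
theorem ERealConvexOn.le_coe {h : E → EReal} (hh : ERealConvexOn h) {u v : E} {p q a b : ℝ}
    (ha : 0 ≤ a) (hb : 0 ≤ b) (hab : a + b = 1) (hu : h u = (p : EReal)) (hv : h v = (q : EReal)) :
    h (a • u + b • v) ≤ ((a * p + b * q : ℝ) : EReal) := by
  have := hh u v a b ha hb hab
  rw [hu, hv] at this
  exact_mod_cast this

theorem EReal.exists_coe_eq_of_le_coe {a : EReal} {b : ℝ} (hbot : a ≠ ⊥) (hab : a ≤ (b : EReal)) :
    ∃ c : ℝ, a = (c : EReal) ∧ c ≤ b := by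
  lift a to ℝ using ⟨ne_top_of_le_ne_top (EReal.coe_ne_top b) hab, hbot⟩
  exact ⟨a, rfl, by exact_mod_cast hab⟩

omit [InnerProductSpace ℝ E] [CompleteSpace E] in
theorem IsEpsOptimal.le_coe {L ε : ℝ} {h : E → EReal} {w u z : E} (hu : IsEpsOptimal L h ε w u)
    {q : ℝ} (hz : h z ≤ (q : EReal)) :
    ((L / 2 * ‖u - w‖ ^ 2 : ℝ) : EReal) + h u ≤ ((ε + (L / 2 * ‖z - w‖ ^ 2 + q) : ℝ) : EReal) := by
  refine hu.trans ?_
  rw [EReal.coe_add]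
  refine add_le_add_right ((iInf_le _ z).trans ?_) _
  rw [proxObj, EReal.coe_add]
  exact add_le_add_right hz _

omit [InnerProductSpace ℝ E] [CompleteSpace E] in
theorem IsEpsOptimal.exists_coe_eq {L ε : ℝ} {h : E → EReal} {w u : E}
    (hu : IsEpsOptimal L h ε w u) (hbot : ∀ z, h z ≠ ⊥) (hproper : ∃ z, h z ≠ ⊤) :
    ∃ p : ℝ, h u = (p : EReal) := by
  obtain ⟨z, hz⟩ := hproper
  have hle := hu.le_coe (EReal.coe_toReal hz (hbot z)).ge
  refine ⟨(h u).toReal, (EReal.coe_toReal (fun htop => ?_) (hbot u)).symm⟩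
  rw [htop, EReal.coe_add_top, top_le_iff] at hle
  exact EReal.coe_ne_top _ hle

theorem norm_sq_convex_combination {V : Type*} [NormedAddCommGroup V] [InnerProductSpace ℝ V]
    {a b : ℝ} (hab : a + b = 1) (u v : V) :
    ‖a • u + b • v‖ ^ 2 = a * ‖u‖ ^ 2 + b * ‖v‖ ^ 2 - a * b * ‖u - v‖ ^ 2 := by
  obtain rfl : b = 1 - a := by linarith
  rw [norm_add_sq_real, norm_sub_sq_real, inner_smul_left, inner_smul_right, norm_smul, norm_smul,
    mul_pow, mul_pow, Real.norm_eq_abs, Real.norm_eq_abs, sq_abs, sq_abs]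
  simp only [conj_trivial]
  ring

omit [CompleteSpace E] in
/-- An approximate minimizer of the strongly convex proximal objective satisfies the quadratic
growth inequality of the exact minimizer, up to an error term. -/
theorem IsEpsOptimal.quadratic_growth {L ε : ℝ} {h : E → EReal} {w u z : E}
    (hu : IsEpsOptimal L h ε w u) (hL : 0 < L) (hε : 0 ≤ ε) (hconv : ERealConvexOn h)
    {p q : ℝ} (hp : h u = (p : EReal)) (hq : h z = (q : EReal)) :
    L / 2 * ‖u - w‖ ^ 2 + p + L / 2 * ‖z - u‖ ^ 2 ≤
      L / 2 * ‖z - w‖ ^ 2 + q + ε + √(2 * L * ε) * ‖z - u‖ := by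
  have key : ∀ θ : ℝ, 0 ≤ θ → θ ≤ 1 → θ * (L / 2 * ‖u - w‖ ^ 2 + p + L / 2 * ‖z - u‖ ^ 2) ≤
      θ * (L / 2 * ‖z - w‖ ^ 2 + q) + ε + L / 2 * θ ^ 2 * ‖z - u‖ ^ 2 := by
    intro θ h0 h1
    have hle := hu.le_coe (hconv.le_coe (sub_nonneg.2 h1) h0 (sub_add_cancel 1 θ) hp hq)
    rw [hp] at hle
    have hle' : L / 2 * ‖u - w‖ ^ 2 + p ≤
        ε + (L / 2 * ‖(1 - θ) • u + θ • z - w‖ ^ 2 + ((1 - θ) * p + θ * q)) := by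
      exact_mod_cast hle
    have hcomb : (1 - θ) • u + θ • z - w = (1 - θ) • (u - w) + θ • (z - w) := by module
    rw [hcomb, norm_sq_convex_combination (sub_add_cancel 1 θ), sub_sub_sub_cancel_right,
      norm_sub_rev u z] at hle'
    linarith
  set s := √(2 * L * ε) with hs
  have hs0 : 0 ≤ s := Real.sqrt_nonneg _
  have hs2 : s ^ 2 = 2 * L * ε := Real.sq_sqrt (by positivity)
  set n := ‖z - u‖ with hn
  have hn0 : 0 ≤ n := norm_nonneg _
  rcases le_or_gt (L * n) s with hsmall | hlarge
  · nlinarith [key 1 zero_le_one le_rfl, mul_le_mul_of_nonneg_right hsmall hn0,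
      key 0 le_rfl zero_le_one, mul_nonneg hs0 hn0]
  · have hnpos : 0 < n := pos_of_mul_pos_right (hs0.trans_lt hlarge) hL.le
    rcases hs0.eq_or_lt with hs00 | hspos
    · have hε0 : ε = 0 := by
        rw [← hs00] at hs2
        have := hL.ne'
        simpa [this] using hs2.symm
      rw [← hs00, hε0]
      rw [hε0] at key
      by_contra! hcon
      set A := L / 2 * ‖u - w‖ ^ 2 + p + L / 2 * n ^ 2
      set B := L / 2 * ‖z - w‖ ^ 2 + q
      have hAB : 0 < A - B := by linarith
      have hpos : 0 < L * n ^ 2 := by positivity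
      have h0 : 0 < (A - B) / (A - B + L * n ^ 2) := by positivity
      have h1 : (A - B) / (A - B + L * n ^ 2) ≤ 1 := by
        rw [div_le_one (by positivity)]; linarith
      have hk := key _ h0.le h1
      have hθ : (A - B) / (A - B + L * n ^ 2) * (A - B + L * n ^ 2) = A - B := by
        field_simp
      generalize (A - B) / (A - B + L * n ^ 2) = θ at *
      have : θ * (A - B) ≤ θ * (θ * (L * n ^ 2) / 2) := by linarith
      have := le_of_mul_le_mul_left this h0
      nlinarith
    · have hθ0 : 0 < s / (L * n) := by positivity
      have hθ1 : s / (L * n) ≤ 1 := by rw [div_le_one (by positivity)]; exact hlarge.le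
      have hk := key _ hθ0.le hθ1
      have hθ : s / (L * n) * (L * n) = s := by field_simp
      generalize s / (L * n) = θ at *
      have hεθ : ε = θ * (s * n / 2) := by
        have h2 : 2 * L * ε = 2 * L * (θ * (s * n / 2)) := by
          rw [← hs2]; linear_combination (-s) * hθ
        exact mul_left_cancel₀ (by positivity) h2
      have hsq : L / 2 * θ ^ 2 * n ^ 2 = θ * (s * n / 2) := by
        rw [← hθ]; ring
      have : θ * (L / 2 * ‖u - w‖ ^ 2 + p + L / 2 * n ^ 2) ≤
          θ * (L / 2 * ‖z - w‖ ^ 2 + q + s * n) := by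
        linarith
      linarith [le_of_mul_le_mul_left this hθ0]

/-- A perturbed contraction whose perturbation decays at a faster geometric rate contracts at the
unperturbed rate. -/
theorem exists_sq_le_mul_pow {s : ℕ → ℝ} {r q c d : ℝ} (hs : ∀ k, 0 ≤ s k) (hq : 0 ≤ q)
    (hqr : q < r) (hc : 0 ≤ c) (hd : 0 ≤ d)
    (hrec : ∀ k, s (k + 1) ^ 2 ≤
      r ^ 2 * s k ^ 2 + (d * q ^ (k + 1)) ^ 2 + c * q ^ (k + 1) * s (k + 1)) :
    ∃ A : ℝ, ∀ k, s k ^ 2 ≤ A * (r ^ 2) ^ k := by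
  have hr : 0 < r := hq.trans_lt hqr
  have hstep : ∀ k, s (k + 1) ≤ r * s k + (c + d) * q ^ (k + 1) := by
    intro k
    have hQ : 0 ≤ q ^ (k + 1) := by positivity
    by_contra! hcon
    have h1 : 0 ≤ r * s k := mul_nonneg hr.le (hs k)
    have h2 : 0 ≤ d * q ^ (k + 1) := mul_nonneg hd hQ
    have h3 : 0 ≤ c * q ^ (k + 1) := mul_nonneg hc hQ
    have := hrec k
    nlinarith [mul_nonneg h1 h2, hs (k + 1)]
  set B := (c + d) * q / (r - q) with hB
  have hrq : 0 < r - q := sub_pos.2 hqr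
  have hBr : B * r - (c + d) * q = B * q := by
    rw [hB]; field_simp; ring
  have hB0 : 0 ≤ B := by positivity
  have hbound : ∀ k, s k ≤ (s 0 + B) * r ^ k - B * q ^ k := by
    intro k
    induction k with
    | zero => simp
    | succ k ih =>
      calc s (k + 1) ≤ r * s k + (c + d) * q ^ (k + 1) := hstep k
        _ ≤ r * ((s 0 + B) * r ^ k - B * q ^ k) + (c + d) * q ^ (k + 1) := by gcongr
        _ = (s 0 + B) * r ^ (k + 1) - B * q ^ (k + 1) := by
          linear_combination (-q ^ k) * hBr
  refine ⟨(s 0 + B) ^ 2, fun k => ?_⟩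
  have hk : s k ≤ (s 0 + B) * r ^ k :=
    (hbound k).trans (sub_le_self _ (by positivity))
  calc s k ^ 2 ≤ ((s 0 + B) * r ^ k) ^ 2 := pow_le_pow_left₀ (hs k) hk 2
    _ = (s 0 + B) ^ 2 * (r ^ 2) ^ k := by ring

/-- The basic inequality for one inexact forward-backward step from `y` to `u`. -/
theorem IsEpsOptimal.forward_backward_le {L ε : ℝ} {g : E → ℝ} {g' : E → E} {h : E → EReal}
    {y e u z : E} (hu : IsEpsOptimal L h ε (y - (1 / L) • (g' y + e)) u)
    (hgrad : ∀ w, HasGradientAt g (g' w) w)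
    (hlip : ∀ w w', ‖g' w - g' w'‖ ≤ L * ‖w - w'‖) (hL : 0 < L) (hε : 0 ≤ ε)
    (hconv : ERealConvexOn h) {p q : ℝ} (hp : h u = (p : EReal)) (hq : h z = (q : EReal)) :
    g u + p + L / 2 * ‖z - u‖ ^ 2 ≤ g y + ⟪g' y, z - y⟫ + L / 2 * ‖z - y‖ ^ 2 + q + ε +
      (‖e‖ + √(2 * L * ε)) * ‖z - u‖ := by
  have hexp : ∀ t : E, L / 2 * ‖t - (y - (1 / L) • (g' y + e))‖ ^ 2 =
      L / 2 * ‖t - y‖ ^ 2 + ⟪g' y, t - y⟫ + ⟪e, t - y⟫ +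
        L / 2 * ‖(1 / L) • (g' y + e)‖ ^ 2 := by
    intro t
    have : t - (y - (1 / L) • (g' y + e)) = (t - y) + (1 / L) • (g' y + e) := by abel
    rw [this, norm_add_sq_real, inner_smul_right, real_inner_comm, inner_add_left]
    field_simp
    ring
  have hgrowth := hu.quadratic_growth hL hε hconv hp hq
  rw [hexp, hexp] at hgrowth
  have hdesc := le_quadratic_of_lipschitz_gradient hgrad hlip y u
  have hcs := real_inner_le_norm e (z - u)
  have hsplit : ⟪e, z - y⟫ = ⟪e, z - u⟫ + ⟪e, u - y⟫ := by
    rw [← inner_add_right, sub_add_sub_cancel]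
  linarith

/-- The Lyapunov inequality for one step of the accelerated inexact proximal-gradient method. -/
theorem IsEpsOptimal.accelerated_step_le {L μ ε α : ℝ} {g : E → ℝ} {g' : E → E} {h : E → EReal}
    {x v y e u v' xstar : E} (hu : IsEpsOptimal L h ε (y - (1 / L) • (g' y + e)) u)
    (hgrad : ∀ w, HasGradientAt g (g' w) w)
    (hlip : ∀ w w', ‖g' w - g' w'‖ ≤ L * ‖w - w'‖)
    (hsc : ∀ w w', g w + ⟪g' w, w' - w⟫ + μ / 2 * ‖w' - w‖ ^ 2 ≤ g w')
    (hL : 0 < L) (hμ : 0 ≤ μ) (hε : 0 ≤ ε) (hconv : ERealConvexOn h) (hbot : ∀ w, h w ≠ ⊥)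
    (hα0 : 0 ≤ α) (hα1 : α ≤ 1) (hα : L * α ^ 2 = μ)
    (hy : (1 + α) • y = x + α • v) (hv' : u = (1 - α) • x + α • v')
    {p q ps : ℝ} (hp : h u = (p : EReal)) (hq : h x = (q : EReal))
    (hps : h xstar = (ps : EReal)) :
    g u + p - (g xstar + ps) + μ / 2 * ‖xstar - v'‖ ^ 2 ≤
      (1 - α) * (g x + q - (g xstar + ps) + μ / 2 * ‖xstar - v‖ ^ 2) + ε +
        α * (‖e‖ + √(2 * L * ε)) * ‖xstar - v'‖ := by
  have h1α : 0 ≤ 1 - α := sub_nonneg.2 hα1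
  obtain ⟨b, hb, hbq⟩ := EReal.exists_coe_eq_of_le_coe (hbot _)
    (hconv.le_coe h1α hα0 (sub_add_cancel 1 α) hq hps)
  have hmain := hu.forward_backward_le hgrad hlip hL hε hconv hp hb
  have hx : x = (1 + α) • y - α • v := by rw [hy]; abel
  have hzu : (1 - α) • x + α • xstar - u = α • (xstar - v') := by rw [hv']; module
  have hzy : (1 - α) • x + α • xstar - y = (1 - α) • (x - y) + α • (xstar - y) := by module
  have hzy' : (1 - α) • x + α • xstar - y =
      α • ((1 - α) • (xstar - v) + α • (xstar - y)) := by rw [hx]; module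
  have hnorm : L / 2 * ‖(1 - α) • x + α • xstar - y‖ ^ 2 ≤
      μ / 2 * ((1 - α) * ‖xstar - v‖ ^ 2 + α * ‖xstar - y‖ ^ 2) := by
    rw [hzy', norm_smul, mul_pow, Real.norm_of_nonneg hα0,
      norm_sq_convex_combination (sub_add_cancel 1 α), ← hα]
    have : 0 ≤ L / 2 * α ^ 2 * ((1 - α) * α * ‖xstar - v - (xstar - y)‖ ^ 2) := by positivity
    linarith
  rw [hzu, norm_smul, Real.norm_of_nonneg hα0] at hmain
  have hinner : ⟪g' y, (1 - α) • x + α • xstar - y⟫ =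
      (1 - α) * ⟪g' y, x - y⟫ + α * ⟪g' y, xstar - y⟫ := by
    rw [hzy, inner_add_right, inner_smul_right, inner_smul_right]
  rw [hinner] at hmain
  have hscx := mul_le_mul_of_nonneg_left (hsc y x) h1α
  have hscs := mul_le_mul_of_nonneg_left (hsc y xstar) hα0
  have hdrop : 0 ≤ (1 - α) * (μ / 2 * ‖x - y‖ ^ 2) := by positivity
  have hquad : L / 2 * (α * ‖xstar - v'‖) ^ 2 = μ / 2 * ‖xstar - v'‖ ^ 2 := by
    rw [← hα]; ring
  linarith

theorem stmt_18
    (L μ : ℝ) (hμ : 0 < μ) (hμL : μ < L)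
    (g : E → ℝ) (g' : E → E)
    (hgrad : ∀ w, HasGradientAt g (g' w) w)
    (hlip : ∀ w w', ‖g' w - g' w'‖ ≤ L * ‖w - w'‖)
    (hsc : ∀ w w', g w + ⟪g' w, w' - w⟫ + μ / 2 * ‖w' - w‖ ^ 2 ≤ g w')
    (h : E → EReal)
    (hhconv : ERealConvexOn h)
    (hhlsc : LowerSemicontinuous h)
    (hhproper : ∃ w, h w ≠ ⊤) (hhnbot : ∀ w, h w ≠ ⊥)
    (f : E → EReal) (hf : ∀ w, f w = ((g w : ℝ) : EReal) + h w)
    (xstar : E) (hmin : ∀ w, f xstar ≤ f w)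
    (γ : ℝ) (hγ : γ = μ / L)
    (x y e : ℕ → E) (ε : ℕ → ℝ) (hεnn : ∀ k, 0 ≤ ε k)
    (hy0 : y 0 = x 0)
    (hy : ∀ k, 1 ≤ k → y k = x k +
      ((1 - Real.sqrt γ) / (1 + Real.sqrt γ)) • (x k - x (k - 1)))
    (hstep : ∀ k, 1 ≤ k →
      IsEpsOptimal L h (ε k) (y (k - 1) - (1 / L) • (g' (y (k - 1)) + e k)) (x k))
    (d0 : ℝ) (hd0 : f (x 0) - f xstar = ((d0 : ℝ) : EReal))
    (C' Q' : ℝ) (hC' : 0 ≤ C') (hQ'nn : 0 ≤ Q') (hQ' : Q' < 1 - Real.sqrt γ)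
    (hedecay : ∀ k, 1 ≤ k → ‖e k‖ ^ 2 ≤ C' * Q' ^ k)
    (hεdecay : ∀ k, 1 ≤ k → ε k ≤ C' * Q' ^ k) :
    ∃ C : ℝ, ∀ k, 1 ≤ k →
      f (x k) - f xstar ≤ ((C * (1 - Real.sqrt γ) ^ k : ℝ) : EReal) := by
  have hL : 0 < L := hμ.trans hμL
  have hγ0 : 0 < γ := hγ ▸ div_pos hμ hL
  have hγ1 : γ < 1 := by rw [hγ, div_lt_one hL]; exact hμL
  set α := √γ with hαdef
  have hα0 : 0 < α := Real.sqrt_pos.2 hγ0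
  have hα1 : α < 1 := (Real.sqrt_lt' one_pos).2 (by rwa [one_pow])
  have h1α : 0 < 1 - α := sub_pos.2 hα1
  have hα : L * α ^ 2 = μ := by
    rw [hαdef, Real.sq_sqrt hγ0.le, hγ]; field_simp
  have hstar : ∃ ps : ℝ, h xstar = (ps : EReal) := by
    obtain ⟨w, hw⟩ := hhproper
    have hle := hmin w
    refine ⟨(h xstar).toReal, (EReal.coe_toReal (fun htop => ?_) (hhnbot xstar)).symm⟩
    rw [hf, hf, htop, EReal.coe_add_top, top_le_iff] at hle
    exact EReal.add_ne_top (EReal.coe_ne_top _) hw hle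
  obtain ⟨ps, hps⟩ := hstar
  have hfstar : f xstar = ((g xstar + ps : ℝ) : EReal) := by
    rw [hf, hps, EReal.coe_add]
  have hxfin : ∀ k, ∃ p : ℝ, h (x k) = (p : EReal) := by
    intro k
    rcases Nat.eq_zero_or_pos k with rfl | hk
    · refine ⟨(h (x 0)).toReal, (EReal.coe_toReal (fun htop => ?_) (hhnbot _)).symm⟩
      rw [hf, htop, EReal.coe_add_top, hfstar, EReal.top_sub_coe] at hd0
      exact EReal.top_ne_coe _ hd0
    · exact (hstep k hk).exists_coe_eq hhnbot hhproper
  choose p hp using hxfin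
  have hfx : ∀ k, f (x k) = ((g (x k) + p k : ℝ) : EReal) := fun k => by
    rw [hf, hp, EReal.coe_add]
  have hgap : ∀ k, 0 ≤ g (x k) + p k - (g xstar + ps) := by
    intro k
    have hle := hmin (x k)
    rw [hfx, hfstar, EReal.coe_le_coe_iff] at hle
    exact sub_nonneg.2 hle
  let v : ℕ → E := fun k => x (k - 1) + α⁻¹ • (x k - x (k - 1))
  let δ : ℕ → ℝ := fun k => g (x k) + p k - (g xstar + ps) + μ / 2 * ‖xstar - v k‖ ^ 2
  have hδ : ∀ k, 0 ≤ δ k := fun k => add_nonneg (hgap k) (by positivity)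
  have hyv : ∀ k, (1 + α) • y k = x k + α • v k := by
    intro k
    have hyk : y k = x k + ((1 - α) / (1 + α)) • (x k - x (k - 1)) := by
      rcases Nat.eq_zero_or_pos k with rfl | hk
      · simp [hy0]
      · exact hy k hk
    have hc : (1 + α) * ((1 - α) / (1 + α)) = 1 - α := by field_simp
    simp only [v]
    rw [hyk, smul_add, smul_add, smul_smul, smul_smul, hc, mul_inv_cancel₀ hα0.ne']
    module
  have hxv : ∀ k, x (k + 1) = (1 - α) • x k + α • v (k + 1) := by
    intro k
    simp only [v, Nat.add_sub_cancel]
    rw [smul_add, smul_smul, mul_inv_cancel₀ hα0.ne']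
    module
  have hpow : ∀ k, √(C' * Q' ^ k) = √C' * √Q' ^ k := fun k => by
    rw [← Real.sqrt_sq (by positivity : 0 ≤ √C' * √Q' ^ k), mul_pow, pow_right_comm,
      Real.sq_sqrt hC', Real.sq_sqrt hQ'nn]
  obtain ⟨A, hA⟩ := exists_sq_le_mul_pow (s := fun k => √(δ k)) (r := √(1 - α)) (q := √Q')
    (c := α * (√C' + √(2 * L) * √C') * √(2 / μ)) (d := √C')
    (fun k => Real.sqrt_nonneg _) (Real.sqrt_nonneg _) (Real.sqrt_lt_sqrt hQ'nn hQ')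
    (by positivity) (Real.sqrt_nonneg _) fun k => by
      have hk : 1 ≤ k + 1 := Nat.le_add_left 1 k
      have hl := (hstep (k + 1) hk).accelerated_step_le hgrad hlip hsc hL hμ.le (hεnn _) hhconv
        hhnbot hα0.le hα1.le hα (hyv k) (hxv k) (hp (k + 1)) (hp k) hps
      have he : ‖e (k + 1)‖ ≤ √C' * √Q' ^ (k + 1) := by
        rw [← hpow]; exact Real.le_sqrt_of_sq_le (hedecay _ hk)
      have hε' : √(2 * L * ε (k + 1)) ≤ √(2 * L) * (√C' * √Q' ^ (k + 1)) := by
        rw [← hpow, ← Real.sqrt_mul (by positivity)]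
        exact Real.sqrt_le_sqrt (mul_le_mul_of_nonneg_left (hεdecay _ hk) (by positivity))
      have hdist : ‖xstar - v (k + 1)‖ ≤ √(2 / μ) * √(δ (k + 1)) := by
        rw [← Real.sqrt_mul (by positivity)]
        refine Real.le_sqrt_of_sq_le ?_
        calc ‖xstar - v (k + 1)‖ ^ 2 = 2 / μ * (μ / 2 * ‖xstar - v (k + 1)‖ ^ 2) := by field_simp
          _ ≤ 2 / μ * δ (k + 1) := by
            gcongr
            exact le_add_of_nonneg_left (hgap _)
      have hεk : ε (k + 1) ≤ (√C' * √Q' ^ (k + 1)) ^ 2 := by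
        rw [← hpow, Real.sq_sqrt (by positivity)]; exact hεdecay _ hk
      rw [Real.sq_sqrt (hδ _), Real.sq_sqrt (hδ _), Real.sq_sqrt h1α.le]
      calc δ (k + 1) ≤ (1 - α) * δ k + ε (k + 1) +
            α * (‖e (k + 1)‖ + √(2 * L * ε (k + 1))) * ‖xstar - v (k + 1)‖ := hl
        _ ≤ (1 - α) * δ k + (√C' * √Q' ^ (k + 1)) ^ 2 +
            α * (√C' * √Q' ^ (k + 1) + √(2 * L) * (√C' * √Q' ^ (k + 1))) *
              (√(2 / μ) * √(δ (k + 1))) := by gcongr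
        _ = _ := by ring
  refine ⟨A, fun k _ => ?_⟩
  have hAk := hA k
  rw [Real.sq_sqrt (hδ k), Real.sq_sqrt h1α.le] at hAk
  rw [hfx, hfstar, ← EReal.coe_sub, EReal.coe_le_coe_iff]
  exact (le_add_of_nonneg_right (by positivity)).trans hAk
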